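/- arXiv:2510.23916 — 8 statements merged into one kernel-verified Lean document; each statement's English description precedes it below -/
import Mathlib

section
/- Let G : ℝ² → ℝ² be given by G(u,v) = (u/(1+√(1+u²+v²)), v/(1+√(1+u²+v²))). For every (u,v) ∈ ℝ² and every pair of vectors w₁ = (a₁,b₁), w₂ = (a₂,b₂) ∈ ℝ², writing (x,y) = G(u,v) and DG(u,v) for the Fréchet derivative of G at (u,v), one has (4/(1-x²-y²)²)·⟨DG(u,v)w₁, DG(u,v)w₂⟩ = ((1+v²)a₁a₂ − uv(a₁b₂ + a₂b₁) + (1+u²)b₁b₂)/(1+u²+v²), where ⟨·,·⟩ is the Euclidean inner product on ℝ². In other words, the pullback under G of the Poincaré disk metric 4(dx²+dy²)/(1-x²-y²)² is the Gans metric h(u,v) = ((1+v²)du² − 2uv du dv + (1+u²)dv²)/(1+u²+v²). -/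
/-- The derivative of `L p / (1 + √(1 + p.1² + p.2²))` for a continuous linear form `L`. -/
theorem fderiv_linear_div_one_add_sqrt (L : ℝ × ℝ →L[ℝ] ℝ) (p w : ℝ × ℝ) :
    DifferentiableAt ℝ (fun q : ℝ × ℝ => L q / (1 + Real.sqrt (1 + q.1 ^ 2 + q.2 ^ 2))) p ∧
    fderiv ℝ (fun q : ℝ × ℝ => L q / (1 + Real.sqrt (1 + q.1 ^ 2 + q.2 ^ 2))) p w =
      L w / (1 + Real.sqrt (1 + p.1 ^ 2 + p.2 ^ 2)) -
        L p * (p.1 * w.1 + p.2 * w.2) /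
          (Real.sqrt (1 + p.1 ^ 2 + p.2 ^ 2) * (1 + Real.sqrt (1 + p.1 ^ 2 + p.2 ^ 2)) ^ 2) := by
  have hpos : 0 < 1 + p.1 ^ 2 + p.2 ^ 2 := by positivity
  have hs : 0 < Real.sqrt (1 + p.1 ^ 2 + p.2 ^ 2) := Real.sqrt_pos.mpr hpos
  have hfst : HasFDerivAt (fun q : ℝ × ℝ => q.1) (ContinuousLinearMap.fst ℝ ℝ ℝ) p :=
    hasFDerivAt_fst
  have hsnd : HasFDerivAt (fun q : ℝ × ℝ => q.2) (ContinuousLinearMap.snd ℝ ℝ ℝ) p :=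
    hasFDerivAt_snd
  have hden := ((((hfst.pow 2).const_add 1).fun_add (hsnd.pow 2)).sqrt hpos.ne').const_add 1
  have hdiv := (L.hasFDerivAt (x := p)).fun_mul
    ((hasDerivAt_inv (by positivity)).comp_hasFDerivAt p hden)
  simp only [Function.comp_apply, ← div_eq_mul_inv] at hdiv
  refine ⟨hdiv.differentiableAt, ?_⟩
  refine (congrArg (fun T => T w) hdiv.fderiv).trans ?_
  simp
  field_simp
  ring

/-- The pullback under `G(u,v) = (u/(1+√(1+u²+v²)), v/(1+√(1+u²+v²)))` of the Poincaré
disk metric `4(dx²+dy²)/(1-x²-y²)²` is the Gans metric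
`h(u,v) = ((1+v²)du² − 2uv du dv + (1+u²)dv²)/(1+u²+v²)`. -/
theorem gans_metric_pullback
    (G : ℝ × ℝ → ℝ × ℝ)
    (hG : ∀ p : ℝ × ℝ,
      G p = (p.1 / (1 + Real.sqrt (1 + p.1 ^ 2 + p.2 ^ 2)),
             p.2 / (1 + Real.sqrt (1 + p.1 ^ 2 + p.2 ^ 2)))) :
    ∀ u v a₁ b₁ a₂ b₂ : ℝ,
      (4 / (1 - (G (u, v)).1 ^ 2 - (G (u, v)).2 ^ 2) ^ 2) *
        ((fderiv ℝ G (u, v) (a₁, b₁)).1 * (fderiv ℝ G (u, v) (a₂, b₂)).1 +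
         (fderiv ℝ G (u, v) (a₁, b₁)).2 * (fderiv ℝ G (u, v) (a₂, b₂)).2) =
      ((1 + v ^ 2) * a₁ * a₂ - u * v * (a₁ * b₂ + a₂ * b₁) + (1 + u ^ 2) * b₁ * b₂) /
        (1 + u ^ 2 + v ^ 2) := by
  intro u v a₁ b₁ a₂ b₂
  have hfderiv (a b : ℝ) : fderiv ℝ G (u, v) (a, b) =
      (a / (1 + Real.sqrt (1 + u ^ 2 + v ^ 2)) - u * (u * a + v * b) /
          (Real.sqrt (1 + u ^ 2 + v ^ 2) * (1 + Real.sqrt (1 + u ^ 2 + v ^ 2)) ^ 2),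
        b / (1 + Real.sqrt (1 + u ^ 2 + v ^ 2)) - v * (u * a + v * b) /
          (Real.sqrt (1 + u ^ 2 + v ^ 2) * (1 + Real.sqrt (1 + u ^ 2 + v ^ 2)) ^ 2)) := by
    obtain ⟨hd₁, he₁⟩ :=
      fderiv_linear_div_one_add_sqrt (ContinuousLinearMap.fst ℝ ℝ ℝ) (u, v) (a, b)
    obtain ⟨hd₂, he₂⟩ :=
      fderiv_linear_div_one_add_sqrt (ContinuousLinearMap.snd ℝ ℝ ℝ) (u, v) (a, b)
    rw [funext hG]
    refine (congrArg (fun T => T (a, b)) (hd₁.fderiv_prodMk hd₂)).trans ?_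
    exact Prod.ext he₁ he₂
  have hsq : Real.sqrt (1 + u ^ 2 + v ^ 2) ^ 2 = 1 + u ^ 2 + v ^ 2 :=
    Real.sq_sqrt (by positivity)
  have hs : 0 < Real.sqrt (1 + u ^ 2 + v ^ 2) := Real.sqrt_pos.mpr (by positivity)
  rw [hfderiv, hfderiv, hG]
  dsimp only
  generalize Real.sqrt (1 + u ^ 2 + v ^ 2) = s at hsq hs ⊢
  have hconf : 1 - (u / (1 + s)) ^ 2 - (v / (1 + s)) ^ 2 = 2 / (1 + s) := by
    field_simp
    linear_combination hsq
  rw [hconf, ← hsq]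
  field_simp
  linear_combination (4 * (1 + s) ^ 2 * (a₁ * a₂ + b₁ * b₂) -
    4 * (u * a₁ + v * b₁) * (u * a₂ + v * b₂)) * hsq
end

section
/- Let f : ℝ² → ℝ be C², let θ ∈ ℝ, let R_θ : ℝ² → ℝ² be the rotation by angle θ about the origin, and define g : ℝ² → ℝ by g(p) = f(R_{−θ} p). Let φ_f(x,y) = (−(f_x(x,y) + y/2), −(f_y(x,y) − x/2)) and φ_g(x,y) = (−(g_x(x,y) + y/2), −(g_y(x,y) − x/2)). Then for every p ∈ ℝ², φ_g(R_θ p) = R_θ(φ_f(p)). Hence if a graph surface in the Heisenberg group is rotated about the z-axis by angle θ, its Gauss map is composed with the rotation r_θ of the Gans plane. -/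
open Real in
/-- Rotating a graph surface in the Heisenberg group about the `z`-axis by angle `θ`
composes its Gauss map with the rotation `r_θ` of the Gans plane:
`φ_g(R_θ p) = R_θ(φ_f(p))`, where `g = f ∘ R_{−θ}`. -/
theorem gauss_map_rotation
    (f : ℝ × ℝ → ℝ) (hf : ContDiff ℝ 2 f) (θ : ℝ)
    (Rθ Rθneg : ℝ × ℝ → ℝ × ℝ)
    (hR : ∀ p : ℝ × ℝ,
      Rθ p = (cos θ * p.1 - sin θ * p.2, sin θ * p.1 + cos θ * p.2))
    (hRneg : ∀ p : ℝ × ℝ,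
      Rθneg p = (cos (-θ) * p.1 - sin (-θ) * p.2, sin (-θ) * p.1 + cos (-θ) * p.2))
    (g : ℝ × ℝ → ℝ) (hg : ∀ p : ℝ × ℝ, g p = f (Rθneg p))
    (φf φg : ℝ × ℝ → ℝ × ℝ)
    (hφf : ∀ p : ℝ × ℝ, φf p =
      (-(fderiv ℝ f p (1, 0) + p.2 / 2), -(fderiv ℝ f p (0, 1) - p.1 / 2)))
    (hφg : ∀ p : ℝ × ℝ, φg p =
      (-(fderiv ℝ g p (1, 0) + p.2 / 2), -(fderiv ℝ g p (0, 1) - p.1 / 2))) :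
    ∀ p : ℝ × ℝ, φg (Rθ p) = Rθ (φf p) := by
  intro p
  let L : ℝ × ℝ →L[ℝ] ℝ × ℝ :=
    (cos θ • ContinuousLinearMap.fst ℝ ℝ ℝ + sin θ • ContinuousLinearMap.snd ℝ ℝ ℝ).prod
      (-sin θ • ContinuousLinearMap.fst ℝ ℝ ℝ + cos θ • ContinuousLinearMap.snd ℝ ℝ ℝ)
  have hL (q : ℝ × ℝ) : L q = (cos θ * q.1 + sin θ * q.2, -sin θ * q.1 + cos θ * q.2) := by
    simp [L]
  have hgL : g = f ∘ L := by
    funext q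
    simp [hg, hRneg, hL]
  have hLR : L (Rθ p) = p := by
    rw [hL, hR]
    ext
    · linear_combination p.1 * sin_sq_add_cos_sq θ
    · linear_combination p.2 * sin_sq_add_cos_sq θ
  have hderiv (v : ℝ × ℝ) : fderiv ℝ g (Rθ p) v =
      (L v).1 * fderiv ℝ f p (1, 0) + (L v).2 * fderiv ℝ f p (0, 1) := by
    have hfd : DifferentiableAt ℝ f (L (Rθ p)) := hf.differentiable (by norm_num) _
    rw [hgL, fderiv_comp _ hfd L.differentiableAt, L.fderiv, hLR,
      ContinuousLinearMap.comp_apply]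
    have hv : L v = (L v).1 • ((1, 0) : ℝ × ℝ) + (L v).2 • ((0, 1) : ℝ × ℝ) := by
      ext <;> simp
    conv_lhs => rw [hv]
    simp only [map_add, map_smul, smul_eq_mul]
  rw [hφg, hR (φf p), hφf, hderiv, hderiv, hL, hL, hR]
  ext <;> ring
end

section
/- For every real constant C, the function f : ℝ² → ℝ defined by f(x,y) = xy/2 + (C/2)[y√(1+y²) + ln(y + √(1+y²))] satisfies the minimal graph equation (1+q²)f_xx − 2pq f_xy + (1+p²)f_yy = 0 at every point of ℝ², where p = f_x + y/2 and q = f_y − x/2. -/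
theorem hasDerivAt_sqrt_one_add_sq (y : ℝ) :
    HasDerivAt (fun t : ℝ => √(1 + t ^ 2)) (y / √(1 + y ^ 2)) y := by
  have h : HasDerivAt (fun t : ℝ => 1 + t ^ 2) (2 * y) y := by
    simpa using (hasDerivAt_pow 2 y).const_add 1
  convert h.sqrt (by positivity) using 1
  rw [mul_div_mul_left _ _ two_ne_zero]

theorem hasDerivAt_mul_sqrt_add_log (y : ℝ) :
    HasDerivAt (fun t : ℝ => t * √(1 + t ^ 2) + Real.log (t + √(1 + t ^ 2)))
      (2 * √(1 + y ^ 2)) y := by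
  have hs := hasDerivAt_sqrt_one_add_sq y
  have hpos : 0 < √(1 + y ^ 2) := by positivity
  have hsq : √(1 + y ^ 2) ^ 2 = 1 + y ^ 2 := Real.sq_sqrt (by positivity)
  have hlog : 0 < y + √(1 + y ^ 2) := by
    have := Real.lt_sqrt_of_sq_lt (show (-y) ^ 2 < 1 + y ^ 2 by linarith [neg_sq y])
    linarith
  refine HasDerivAt.congr_deriv
    (((hasDerivAt_id' y).mul hs).add (((hasDerivAt_id' y).add hs).log hlog.ne')) ?_
  simp only [Pi.add_apply]
  generalize √(1 + y ^ 2) = s at *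
  have hlog_ne := hlog.ne'
  field_simp
  linear_combination (-(s + y)) * hsq

/-- The derivative of `(x, y) ↦ a(x, y) + g(y)`, where `a` is differentiable, along `v`. -/
theorem fderiv_add_comp_snd_apply {a : ℝ × ℝ → ℝ} {g : ℝ → ℝ} {g' : ℝ} {p : ℝ × ℝ}
    (ha : DifferentiableAt ℝ a p) (hg : HasDerivAt g g' p.2) (v : ℝ × ℝ) :
    fderiv ℝ (fun q : ℝ × ℝ => a q + g q.2) p v = fderiv ℝ a p v + g' * v.2 := by
  have h := ha.hasFDerivAt.add (hg.comp_hasFDerivAt p hasFDerivAt_snd)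
  have h' : HasFDerivAt (fun q : ℝ × ℝ => a q + g q.2) _ p := h
  rw [h'.fderiv]
  simp

theorem fderiv_fst_mul_snd_div_two_apply (p v : ℝ × ℝ) :
    fderiv ℝ (fun q : ℝ × ℝ => q.1 * q.2 / 2) p v = (p.1 * v.2 + p.2 * v.1) / 2 := by
  have h : HasFDerivAt (fun q : ℝ × ℝ => q.1 * q.2 / 2) _ p :=
    ((hasFDerivAt_fst (𝕜 := ℝ) (p := p)).mul (hasFDerivAt_snd (𝕜 := ℝ) (p := p))).mul_const 2⁻¹
  rw [h.fderiv]
  simp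
  ring

theorem fderiv_fst_div_two_apply (p v : ℝ × ℝ) :
    fderiv ℝ (fun q : ℝ × ℝ => q.1 / 2) p v = v.1 / 2 := by
  have h : HasFDerivAt (fun q : ℝ × ℝ => q.1 / 2) _ p :=
    (hasFDerivAt_fst (𝕜 := ℝ) (p := p)).mul_const 2⁻¹
  rw [h.fderiv]
  simp
  ring

theorem fderiv_snd_div_two_apply (p v : ℝ × ℝ) :
    fderiv ℝ (fun q : ℝ × ℝ => q.2 / 2) p v = v.2 / 2 := by
  have h : HasFDerivAt (fun q : ℝ × ℝ => q.2 / 2) _ p :=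
    (hasFDerivAt_snd (𝕜 := ℝ) (p := p)).mul_const 2⁻¹
  rw [h.fderiv]
  simp
  ring

/-- For every real constant `C`, the translation surface
`f(x,y) = xy/2 + (C/2)[y√(1+y²) + ln(y + √(1+y²))]` is a minimal graph in the
Heisenberg group: it satisfies `(1+q²)f_xx − 2pq f_xy + (1+p²)f_yy = 0` everywhere,
where `p = f_x + y/2` and `q = f_y − x/2`. -/
theorem minimal_translation_surface_example (C : ℝ)
    (f : ℝ × ℝ → ℝ)
    (hf : ∀ p : ℝ × ℝ, f p = p.1 * p.2 / 2 +
      C / 2 * (p.2 * Real.sqrt (1 + p.2 ^ 2) + Real.log (p.2 + Real.sqrt (1 + p.2 ^ 2))))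
    (fx fy fxx fxy fyy : ℝ × ℝ → ℝ)
    (hfx : ∀ p, fx p = fderiv ℝ f p (1, 0))
    (hfy : ∀ p, fy p = fderiv ℝ f p (0, 1))
    (hfxx : ∀ p, fxx p = fderiv ℝ fx p (1, 0))
    (hfxy : ∀ p, fxy p = fderiv ℝ fx p (0, 1))
    (hfyy : ∀ p, fyy p = fderiv ℝ fy p (0, 1)) :
    ∀ p : ℝ × ℝ,
      (1 + (fy p - p.1 / 2) ^ 2) * fxx p -
        2 * (fx p + p.2 / 2) * (fy p - p.1 / 2) * fxy p +
        (1 + (fx p + p.2 / 2) ^ 2) * fyy p = 0 := by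
  have hdf (p v : ℝ × ℝ) :
      fderiv ℝ f p v = (p.1 * v.2 + p.2 * v.1) / 2 + C * √(1 + p.2 ^ 2) * v.2 := by
    rw [funext hf, fderiv_add_comp_snd_apply (by fun_prop)
      ((hasDerivAt_mul_sqrt_add_log p.2).const_mul (C / 2)), fderiv_fst_mul_snd_div_two_apply]
    ring
  have hfx' : fx = fun q => q.2 / 2 := by
    ext q
    simp [hfx, hdf]
  have hfy' : fy = fun q => q.1 / 2 + C * √(1 + q.2 ^ 2) := by
    ext q
    simp [hfy, hdf]
  intro p
  have hfyy' : fyy p = C * (p.2 / √(1 + p.2 ^ 2)) := by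
    rw [hfyy, hfy', fderiv_add_comp_snd_apply (by fun_prop)
      ((hasDerivAt_sqrt_one_add_sq p.2).const_mul C), fderiv_fst_div_two_apply]
    simp
  rw [hfyy', hfxx, hfxy, hfx', hfy', fderiv_snd_div_two_apply, fderiv_snd_div_two_apply]
  have hpos : 0 < √(1 + p.2 ^ 2) := by positivity
  have hsq : √(1 + p.2 ^ 2) ^ 2 = 1 + p.2 ^ 2 := Real.sq_sqrt (by positivity)
  simp only
  generalize √(1 + p.2 ^ 2) = s at *
  field_simp
  linear_combination (-8 * C * p.2) * hsq
end

section
/- Let I, J ⊆ ℝ be open intervals, u : I → ℝ and v : J → ℝ be C² functions, and define f : I × J → ℝ by f(x,y) = u(x) + v(y) + xy/2. Then for each (x,y) ∈ I × J, f satisfies the flat graph equation w²(f_xy² − f_xx f_yy − 1/4) − (1+q²)((f_xy + 1/2)² − f_xx f_yy) − (1+p²)((f_xy − 1/2)² − f_xx f_yy) + pq(f_yy − f_xx) = 0 (where p = f_x + y/2, q = f_y − x/2, w² = 1 + p² + q²) at (x,y) if and only if 1 + v'(y)² = u''(x)v''(y) + (y + u'(x))·v'(y)·(v''(y) − u''(x)).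 -/
/-- The derivative of `p ↦ a p.1 + b p.2 + k * (p.1 * p.2)`. -/
theorem fderiv_separated_add_mul_apply {a b : ℝ → ℝ} {x y : ℝ} (k : ℝ)
    (ha : DifferentiableAt ℝ a x) (hb : DifferentiableAt ℝ b y) (h : ℝ × ℝ) :
    fderiv ℝ (fun p : ℝ × ℝ => a p.1 + b p.2 + k * (p.1 * p.2)) (x, y) h =
      (deriv a x + k * y) * h.1 + (deriv b y + k * x) * h.2 := by
  have h₁ : HasFDerivAt (fun p : ℝ × ℝ => p.1) (ContinuousLinearMap.fst ℝ ℝ ℝ) (x, y) :=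
    hasFDerivAt_fst
  have h₂ : HasFDerivAt (fun p : ℝ × ℝ => p.2) (ContinuousLinearMap.snd ℝ ℝ ℝ) (x, y) :=
    hasFDerivAt_snd
  have ha' := HasDerivAt.comp_hasFDerivAt (h₂ := a) (x, y) ha.hasDerivAt h₁
  have hb' := HasDerivAt.comp_hasFDerivAt (h₂ := b) (x, y) hb.hasDerivAt h₂
  have key : HasFDerivAt (fun p : ℝ × ℝ => a p.1 + b p.2 + k * (p.1 * p.2)) _ (x, y) :=
    (ha'.add hb').add ((h₁.mul h₂).const_mul k)
  rw [key.fderiv]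
  simp
  ring

/-- A `C²` function on an open set is differentiable there, and so is its derivative. -/
theorem ContDiffOn.differentiableAt_and_deriv {u : ℝ → ℝ} {I : Set ℝ} (hI : IsOpen I)
    (hu : ContDiffOn ℝ 2 u I) {x : ℝ} (hx : x ∈ I) :
    DifferentiableAt ℝ u x ∧ DifferentiableAt ℝ (deriv u) x :=
  ⟨(hu.differentiableOn (by norm_num)).differentiableAt (hI.mem_nhds hx),
    ((hu.deriv_of_isOpen (m := 1) hI (by norm_num)).differentiableOn
      (by norm_num)).differentiableAt (hI.mem_nhds hx)⟩

/-- The translation surface `f(x,y) = u(x) + v(y) + xy/2` in the Heisenberg group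
satisfies the flat graph equation
`w²(f_xy² − f_xx f_yy − 1/4) − (1+q²)((f_xy+1/2)² − f_xx f_yy)
  − (1+p²)((f_xy−1/2)² − f_xx f_yy) + pq(f_yy − f_xx) = 0`
(with `p = f_x + y/2`, `q = f_y − x/2`, `w² = 1+p²+q²`) at `(x,y)` if and only if
`1 + v'(y)² = u''(x)v''(y) + (y + u'(x))·v'(y)·(v''(y) − u''(x))`. -/
theorem flat_translation_surface_equation
    (I J : Set ℝ) (hI : IsOpen I) (hI' : I.OrdConnected)
    (hJ : IsOpen J) (hJ' : J.OrdConnected)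
    (u v : ℝ → ℝ) (hu : ContDiffOn ℝ 2 u I) (hv : ContDiffOn ℝ 2 v J)
    (f : ℝ × ℝ → ℝ) (hf : ∀ p : ℝ × ℝ, f p = u p.1 + v p.2 + p.1 * p.2 / 2)
    (fx fy fxx fxy fyy : ℝ × ℝ → ℝ)
    (hfx : ∀ p, fx p = fderiv ℝ f p (1, 0))
    (hfy : ∀ p, fy p = fderiv ℝ f p (0, 1))
    (hfxx : ∀ p, fxx p = fderiv ℝ fx p (1, 0))
    (hfxy : ∀ p, fxy p = fderiv ℝ fx p (0, 1))
    (hfyy : ∀ p, fyy p = fderiv ℝ fy p (0, 1)) :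
    ∀ x ∈ I, ∀ y ∈ J,
      ((1 + (fx (x, y) + y / 2) ^ 2 + (fy (x, y) - x / 2) ^ 2) *
          (fxy (x, y) ^ 2 - fxx (x, y) * fyy (x, y) - 1 / 4) -
        (1 + (fy (x, y) - x / 2) ^ 2) *
          ((fxy (x, y) + 1 / 2) ^ 2 - fxx (x, y) * fyy (x, y)) -
        (1 + (fx (x, y) + y / 2) ^ 2) *
          ((fxy (x, y) - 1 / 2) ^ 2 - fxx (x, y) * fyy (x, y)) +
        (fx (x, y) + y / 2) * (fy (x, y) - x / 2) * (fyy (x, y) - fxx (x, y)) = 0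
        ↔
       1 + deriv v y ^ 2 =
          deriv (deriv u) x * deriv (deriv v) y +
            (y + deriv u x) * deriv v y * (deriv (deriv v) y - deriv (deriv u) x)) := by
  intro x hx y hy
  have hf' : f = fun p : ℝ × ℝ => u p.1 + v p.2 + 1 / 2 * (p.1 * p.2) := by
    funext p
    rw [hf]
    ring
  have hfderiv : ∀ p ∈ I ×ˢ J, ∀ h, fderiv ℝ f p h =
      (deriv u p.1 + 1 / 2 * p.2) * h.1 + (deriv v p.2 + 1 / 2 * p.1) * h.2 := by
    rintro ⟨a, b⟩ ⟨ha, hb⟩ h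
    rw [hf']
    exact fderiv_separated_add_mul_apply _ (hu.differentiableAt_and_deriv hI ha).1
      (hv.differentiableAt_and_deriv hJ hb).1 h
  have hmem : (x, y) ∈ I ×ˢ J := ⟨hx, hy⟩
  have hnhds : I ×ˢ J ∈ nhds (x, y) := (hI.prod hJ).mem_nhds hmem
  have hlin : ∀ t : ℝ, DifferentiableAt ℝ (fun s : ℝ => 1 / 2 * s) t := fun t => by fun_prop
  have hderiv_lin : ∀ t : ℝ, deriv (fun s : ℝ => 1 / 2 * s) t = 1 / 2 := fun t => by
    simp
  have hfx_eq : fx =ᶠ[nhds (x, y)]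
      fun p => deriv u p.1 + (fun s : ℝ => 1 / 2 * s) p.2 + 0 * (p.1 * p.2) := by
    filter_upwards [hnhds] with p hp
    rw [hfx, hfderiv p hp]
    ring
  have hfy_eq : fy =ᶠ[nhds (x, y)]
      fun p => (fun s : ℝ => 1 / 2 * s) p.1 + deriv v p.2 + 0 * (p.1 * p.2) := by
    filter_upwards [hnhds] with p hp
    rw [hfy, hfderiv p hp]
    ring
  have hux := (hu.differentiableAt_and_deriv hI hx).2
  have hvy := (hv.differentiableAt_and_deriv hJ hy).2
  have efxx : fxx (x, y) = deriv (deriv u) x := by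
    rw [hfxx, hfx_eq.fderiv_eq, fderiv_separated_add_mul_apply 0 hux (hlin y)]
    ring
  have efxy : fxy (x, y) = 1 / 2 := by
    rw [hfxy, hfx_eq.fderiv_eq, fderiv_separated_add_mul_apply 0 hux (hlin y), hderiv_lin]
    ring
  have efyy : fyy (x, y) = deriv (deriv v) y := by
    rw [hfyy, hfy_eq.fderiv_eq, fderiv_separated_add_mul_apply 0 (hlin x) hvy]
    ring
  rw [efxx, efxy, efyy, hfx_eq.eq_of_nhds, hfy_eq.eq_of_nhds]
  constructor <;> intro h <;> linear_combination -h
end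

section
/- Let I, J ⊆ ℝ be nonempty open intervals, A, B ∈ ℝ, u(x) = Ax + B, and let v : J → ℝ be C² with v''(y) ≠ 0 for all y ∈ J. Suppose that for all (x,y) ∈ I × J the equation 1 + v'(y)² = u''(x)v''(y) + (y + u'(x))·v'(y)·(v''(y) − u''(x)) holds (equivalently, the translation surface f(x,y) = u(x) + v(y) + xy/2 is flat). Then there exists a constant C > 0 such that v'(y)² = C(A+y)² − 1 for all y ∈ J. -/
/-- If `1 + p² = (A + y) p p'` on a preconnected open set of reals, then `(1 + p²) / (A + y)²`
is constant there. -/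
theorem exists_sq_eq_mul_sq_sub_one_of_hasDerivAt {J : Set ℝ} (hJ : IsOpen J)
    (hJc : IsPreconnected J) (hJne : J.Nonempty) {A : ℝ} {p p' : ℝ → ℝ}
    (hp : ∀ y ∈ J, HasDerivAt p (p' y) y)
    (hode : ∀ y ∈ J, 1 + p y ^ 2 = (A + y) * p y * p' y) :
    ∃ C : ℝ, 0 < C ∧ ∀ y ∈ J, p y ^ 2 = C * (A + y) ^ 2 - 1 := by
  have hne : ∀ y ∈ J, A + y ≠ 0 := by
    intro y hy h0
    have h := hode y hy
    rw [h0] at h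
    nlinarith [sq_nonneg (p y)]
  have hder : ∀ y ∈ J, HasDerivAt (fun z => (1 + p z ^ 2) / (A + z) ^ 2) 0 y := by
    intro y hy
    have h := (((hp y hy).pow 2).const_add 1).div
      (((hasDerivAt_id y).const_add A).pow 2) (pow_ne_zero 2 (hne y hy))
    refine h.congr_deriv ?_
    rw [div_eq_zero_iff]
    left
    simp only [id, Pi.pow_apply]
    push_cast
    linear_combination (-2 * (A + y)) * hode y hy
  obtain ⟨y₀, hy₀⟩ := hJne
  refine ⟨(1 + p y₀ ^ 2) / (A + y₀) ^ 2, ?_, fun y hy => ?_⟩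
  · have := hne y₀ hy₀
    positivity
  · have h := hJ.is_const_of_deriv_eq_zero hJc
      (fun z hz => (hder z hz).differentiableAt.differentiableWithinAt)
      (fun z hz => (hder z hz).deriv) hy hy₀
    have := hne y hy
    rw [← h, div_mul_cancel₀ _ (pow_ne_zero 2 this)]
    ring

/-- Classification of flat non-parametric translation surfaces with vanishing Gauss map
determinant, case `u'' ≡ 0`, `v''` never zero: if `u(x) = Ax + B` and the flatness
equation `1 + v'² = u''v'' + (y + u')v'(v'' − u'')` holds on `I × J`, then there is a
constant `C > 0` with `v'(y)² = C(A+y)² − 1` on `J`. -/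
theorem flat_translation_surface_vanishing_det
    (I J : Set ℝ) (hI : IsOpen I) (hI' : I.OrdConnected) (hIne : I.Nonempty)
    (hJ : IsOpen J) (hJ' : J.OrdConnected) (hJne : J.Nonempty)
    (A B : ℝ) (u : ℝ → ℝ) (hu : ∀ x : ℝ, u x = A * x + B)
    (v : ℝ → ℝ) (hv : ContDiffOn ℝ 2 v J)
    (hv'' : ∀ y ∈ J, deriv (deriv v) y ≠ 0)
    (hflat : ∀ x ∈ I, ∀ y ∈ J,
      1 + deriv v y ^ 2 =
        deriv (deriv u) x * deriv (deriv v) y +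
          (y + deriv u x) * deriv v y * (deriv (deriv v) y - deriv (deriv u) x)) :
    ∃ C : ℝ, 0 < C ∧ ∀ y ∈ J, deriv v y ^ 2 = C * (A + y) ^ 2 - 1 := by
  have hu' : deriv u = fun _ => A := by
    ext x
    rw [funext hu]
    simp
  obtain ⟨x, hx⟩ := hIne
  have hdiff : DifferentiableOn ℝ (deriv v) J :=
    (hv.deriv_of_isOpen (m := 1) hJ (by norm_num)).differentiableOn (by norm_num)
  refine exists_sq_eq_mul_sq_sub_one_of_hasDerivAt hJ hJ'.isPreconnected hJne
    (fun y hy => (hdiff.differentiableAt (hJ.mem_nhds hy)).hasDerivAt) fun y hy => ?_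
  have h := hflat x hx y hy
  simp only [hu', deriv_const] at h
  linear_combination h
end

section
/- Let A ∈ ℝ, C > 0, and let J ⊆ ℝ be an open interval on which C(A+y)² > 1. Let v : J → ℝ be C² with v'(y)² = C(A+y)² − 1 for all y ∈ J. Then for any B ∈ ℝ, the function f(x,y) = xy/2 + Ax + B + v(y) satisfies the flat graph equation w²(f_xy² − f_xx f_yy − 1/4) − (1+q²)((f_xy + 1/2)² − f_xx f_yy) − (1+p²)((f_xy − 1/2)² − f_xx f_yy) + pq(f_yy − f_xx) = 0 (where p = f_x + y/2, q = f_y − x/2, w² = 1 + p² + q²) at every point of ℝ × J. -/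
open Filter Topology

/-- The Fréchet derivative of `p ↦ xy/2 + Ax + B + v(y)`, applied to a vector. -/
lemma fderiv_translationGraph_apply {A B : ℝ} {v : ℝ → ℝ} {p : ℝ × ℝ}
    (hv : DifferentiableAt ℝ v p.2) (h : ℝ × ℝ) :
    fderiv ℝ (fun p : ℝ × ℝ => p.1 * p.2 / 2 + A * p.1 + B + v p.2) p h =
      (p.2 / 2 + A) * h.1 + (p.1 / 2 + deriv v p.2) * h.2 := by
  have h₁ : HasFDerivAt (fun p : ℝ × ℝ => p.1) (ContinuousLinearMap.fst ℝ ℝ ℝ) p :=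
    hasFDerivAt_fst
  have h₂ : HasFDerivAt (fun p : ℝ × ℝ => p.2) (ContinuousLinearMap.snd ℝ ℝ ℝ) p :=
    hasFDerivAt_snd
  have key := ((((h₁.mul h₂).mul_const (1 / 2)).add (h₁.const_mul A)).add_const B).add
    (hv.hasDerivAt.comp_hasFDerivAt p h₂)
  have heq : (fun p : ℝ × ℝ => p.1 * p.2 / 2 + A * p.1 + B + v p.2) =
      (fun p : ℝ × ℝ => p.1 * p.2 * (1 / 2) + A * p.1 + B + v p.2) := by
    funext p
    ring
  rw [heq]
  refine (congrArg (fun L => L h) key.fderiv).trans ?_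
  simp
  ring

/-- If `v'(y)² = C(A+y)² − 1` on an open interval `J` where `C(A+y)² > 1`, then the
translation surface `f(x,y) = xy/2 + Ax + B + v(y)` satisfies the flat graph equation
at every point of `ℝ × J`. -/
theorem flat_translation_surface_example
    (A C B : ℝ) (hC : 0 < C)
    (J : Set ℝ) (hJ : IsOpen J) (hJ' : J.OrdConnected)
    (hJC : ∀ y ∈ J, 1 < C * (A + y) ^ 2)
    (v : ℝ → ℝ) (hv : ContDiffOn ℝ 2 v J)
    (hv' : ∀ y ∈ J, deriv v y ^ 2 = C * (A + y) ^ 2 - 1)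
    (f : ℝ × ℝ → ℝ)
    (hf : ∀ p : ℝ × ℝ, f p = p.1 * p.2 / 2 + A * p.1 + B + v p.2)
    (fx fy fxx fxy fyy : ℝ × ℝ → ℝ)
    (hfx : ∀ p, fx p = fderiv ℝ f p (1, 0))
    (hfy : ∀ p, fy p = fderiv ℝ f p (0, 1))
    (hfxx : ∀ p, fxx p = fderiv ℝ fx p (1, 0))
    (hfxy : ∀ p, fxy p = fderiv ℝ fx p (0, 1))
    (hfyy : ∀ p, fyy p = fderiv ℝ fy p (0, 1)) :
    ∀ x : ℝ, ∀ y ∈ J,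
      (1 + (fx (x, y) + y / 2) ^ 2 + (fy (x, y) - x / 2) ^ 2) *
          (fxy (x, y) ^ 2 - fxx (x, y) * fyy (x, y) - 1 / 4) -
        (1 + (fy (x, y) - x / 2) ^ 2) *
          ((fxy (x, y) + 1 / 2) ^ 2 - fxx (x, y) * fyy (x, y)) -
        (1 + (fx (x, y) + y / 2) ^ 2) *
          ((fxy (x, y) - 1 / 2) ^ 2 - fxx (x, y) * fyy (x, y)) +
        (fx (x, y) + y / 2) * (fy (x, y) - x / 2) * (fyy (x, y) - fxx (x, y)) = 0 := by
  intro x y hy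
  obtain rfl : f = fun p => p.1 * p.2 / 2 + A * p.1 + B + v p.2 := funext hf
  have hdv : ∀ z ∈ J, DifferentiableAt ℝ v z := fun z hz =>
    (hv.differentiableOn (by norm_num)).differentiableAt (hJ.mem_nhds hz)
  have hddv : HasDerivAt (deriv v) (deriv (deriv v) y) y :=
    (((hv.deriv_of_isOpen (m := 1) hJ (by norm_num)).differentiableOn
      (by norm_num)).differentiableAt (hJ.mem_nhds hy)).hasDerivAt
  have hfx_eq : ∀ p : ℝ × ℝ, p.2 ∈ J → fx p = p.2 / 2 + A := fun p hp => by
    simp [hfx, fderiv_translationGraph_apply (hdv _ hp)]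
  have hfy_eq : ∀ p : ℝ × ℝ, p.2 ∈ J → fy p = p.1 / 2 + deriv v p.2 := fun p hp => by
    simp [hfy, fderiv_translationGraph_apply (hdv _ hp)]
  have hnhds : ∀ᶠ p : ℝ × ℝ in 𝓝 (x, y), p.2 ∈ J :=
    continuous_snd.continuousAt.eventually (hJ.mem_nhds hy)
  have h₁ : HasFDerivAt (fun p : ℝ × ℝ => p.1) (ContinuousLinearMap.fst ℝ ℝ ℝ) (x, y) :=
    hasFDerivAt_fst
  have h₂ : HasFDerivAt (fun p : ℝ × ℝ => p.2) (ContinuousLinearMap.snd ℝ ℝ ℝ) (x, y) :=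
    hasFDerivAt_snd
  have hdfx := ((h₂.mul_const (1 / 2)).add_const A).congr_of_eventuallyEq
    (f₁ := fx) (hnhds.mono fun p hp => by rw [hfx_eq p hp]; ring)
  have hdfy := ((h₁.mul_const (1 / 2)).add
    (HasDerivAt.comp_hasFDerivAt (x, y) hddv h₂)).congr_of_eventuallyEq
    (f₁ := fy) (hnhds.mono fun p hp => by
      rw [hfy_eq p hp]
      simp only [Pi.add_apply, Function.comp_apply]
      ring)
  have hxx : fxx (x, y) = 0 := by simp [hfxx, hdfx.fderiv]
  have hxy : fxy (x, y) = 1 / 2 := by simp [hfxy, hdfx.fderiv]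
  have hyy : fyy (x, y) = deriv (deriv v) y := by simp [hfyy, hdfy.fderiv]
  have hode : deriv v y * deriv (deriv v) y = C * (A + y) := by
    have hl := hddv.pow 2
    have hr : HasDerivAt (fun z => C * (A + z) ^ 2 - 1) (C * (2 * (A + y))) y := by
      simpa using ((((hasDerivAt_id y).const_add A).pow 2).const_mul C).sub_const 1
    have hu := hl.unique (hr.congr_of_eventuallyEq
      (eventually_of_mem (hJ.mem_nhds hy) hv'))
    norm_num at hu
    linarith
  rw [hxx, hxy, hyy, hfx_eq _ hy, hfy_eq _ hy]
  linear_combination (A + y) * hode - hv' y hy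
end

section
/- Let I, J ⊆ ℝ be nonempty open intervals, let u : I → ℝ be C², and let A, B ∈ ℝ. Then the function f(x,y) = u(x) + Ay + B + xy/2 does NOT satisfy the flat graph equation at every point of I × J; equivalently, there is no flat non-parametric translation surface f(x,y) = u(x) + v(y) + xy/2 in the Heisenberg group with v affine (v'' ≡ 0). -/
/-- The Fréchet derivative of `(x, y) ↦ g x + A y + B + C x y`, evaluated at a vector. -/
theorem fderiv_add_affine_add_mul_apply {g : ℝ → ℝ} {p : ℝ × ℝ} (hg : DifferentiableAt ℝ g p.1)
    (A B C : ℝ) (v : ℝ × ℝ) :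
    fderiv ℝ (fun q : ℝ × ℝ => g q.1 + A * q.2 + B + C * (q.1 * q.2)) p v =
      deriv g p.1 * v.1 + A * v.2 + C * (p.1 * v.2 + p.2 * v.1) := by
  have h₁ : HasFDerivAt (fun q : ℝ × ℝ => q.1) (ContinuousLinearMap.fst ℝ ℝ ℝ) p := hasFDerivAt_fst
  have h₂ : HasFDerivAt (fun q : ℝ × ℝ => q.2) (ContinuousLinearMap.snd ℝ ℝ ℝ) p := hasFDerivAt_snd
  have hg' : HasFDerivAt (fun q : ℝ × ℝ => g q.1)
      (deriv g p.1 • ContinuousLinearMap.fst ℝ ℝ ℝ) p := hg.hasDerivAt.comp_hasFDerivAt p h₁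
  have h := ((hg'.add (h₂.const_mul A)).add_const B).add ((h₁.mul h₂).const_mul C)
  refine (DFunLike.congr_fun h.fderiv v).trans ?_
  simp [mul_add]

/-- There is no flat non-parametric translation surface `f(x,y) = u(x) + v(y) + xy/2`
in the Heisenberg group with `v` affine: the function `f(x,y) = u(x) + Ay + B + xy/2`
never satisfies the flat graph equation at every point of `I × J`. -/
theorem no_flat_translation_surface_with_v_affine
    (I J : Set ℝ) (hI : IsOpen I) (hI' : I.OrdConnected) (hIne : I.Nonempty)
    (hJ : IsOpen J) (hJ' : J.OrdConnected) (hJne : J.Nonempty)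
    (u : ℝ → ℝ) (hu : ContDiffOn ℝ 2 u I) (A B : ℝ)
    (f : ℝ × ℝ → ℝ)
    (hf : ∀ p : ℝ × ℝ, f p = u p.1 + A * p.2 + B + p.1 * p.2 / 2)
    (fx fy fxx fxy fyy : ℝ × ℝ → ℝ)
    (hfx : ∀ p, fx p = fderiv ℝ f p (1, 0))
    (hfy : ∀ p, fy p = fderiv ℝ f p (0, 1))
    (hfxx : ∀ p, fxx p = fderiv ℝ fx p (1, 0))
    (hfxy : ∀ p, fxy p = fderiv ℝ fx p (0, 1))
    (hfyy : ∀ p, fyy p = fderiv ℝ fy p (0, 1)) :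
    ¬ (∀ x ∈ I, ∀ y ∈ J,
      (1 + (fx (x, y) + y / 2) ^ 2 + (fy (x, y) - x / 2) ^ 2) *
          (fxy (x, y) ^ 2 - fxx (x, y) * fyy (x, y) - 1 / 4) -
        (1 + (fy (x, y) - x / 2) ^ 2) *
          ((fxy (x, y) + 1 / 2) ^ 2 - fxx (x, y) * fyy (x, y)) -
        (1 + (fx (x, y) + y / 2) ^ 2) *
          ((fxy (x, y) - 1 / 2) ^ 2 - fxx (x, y) * fyy (x, y)) +
        (fx (x, y) + y / 2) * (fy (x, y) - x / 2) * (fyy (x, y) - fxx (x, y)) = 0) := by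
  intro h
  have hu' : ∀ x ∈ I, DifferentiableAt ℝ u x := fun x hx =>
    (hu.differentiableOn (by norm_num)).differentiableAt (hI.mem_nhds hx)
  have hdu : ∀ x ∈ I, DifferentiableAt ℝ (deriv u) x := fun x hx =>
    ((hu.deriv_of_isOpen hI (m := 1) (by norm_num)).differentiableOn
      (by norm_num)).differentiableAt (hI.mem_nhds hx)
  have hf' : f = fun q : ℝ × ℝ => u q.1 + A * q.2 + B + 1 / 2 * (q.1 * q.2) := by
    funext q
    rw [hf]
    ring
  have hfx' : ∀ p : ℝ × ℝ, p.1 ∈ I →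
      fx p = deriv u p.1 + 1 / 2 * p.2 + 0 + 0 * (p.1 * p.2) := fun p hp => by
    rw [hfx, hf', fderiv_add_affine_add_mul_apply (hu' _ hp)]
    ring
  have hfy' : ∀ p : ℝ × ℝ, p.1 ∈ I →
      fy p = 1 / 2 * p.1 + 0 * p.2 + A + 0 * (p.1 * p.2) := fun p hp => by
    rw [hfy, hf', fderiv_add_affine_add_mul_apply (hu' _ hp)]
    ring
  obtain ⟨x, hx⟩ := hIne
  have hI_nhds : ∀ y : ℝ, ∀ᶠ p in nhds (x, y), p.1 ∈ I := fun y =>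
    continuousAt_fst.eventually (hI.mem_nhds hx)
  have hfx_nhds : ∀ y, fx =ᶠ[nhds (x, y)]
      fun p => deriv u p.1 + 1 / 2 * p.2 + 0 + 0 * (p.1 * p.2) := fun y => (hI_nhds y).mono hfx'
  have hfy_nhds : ∀ y, fy =ᶠ[nhds (x, y)]
      fun p => 1 / 2 * p.1 + 0 * p.2 + A + 0 * (p.1 * p.2) := fun y => (hI_nhds y).mono hfy'
  have hfxx' : ∀ y, fxx (x, y) = deriv (deriv u) x := fun y => by
    rw [hfxx, (hfx_nhds y).fderiv_eq, fderiv_add_affine_add_mul_apply (hdu x hx)]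
    ring
  have hfxy' : ∀ y, fxy (x, y) = 1 / 2 := fun y => by
    rw [hfxy, (hfx_nhds y).fderiv_eq, fderiv_add_affine_add_mul_apply (hdu x hx)]
    ring
  have hfyy' : ∀ y, fyy (x, y) = 0 := fun y => by
    rw [hfyy, (hfy_nhds y).fderiv_eq,
      fderiv_add_affine_add_mul_apply (g := fun t => 1 / 2 * t) (by fun_prop)]
    ring
  have key : ∀ y ∈ J, 1 + A ^ 2 + A * (deriv u x + y) * deriv (deriv u) x = 0 := fun y hy => by
    have := h x hx y hy
    rw [hfxx', hfxy', hfyy', hfx' _ hx, hfy' _ hx] at this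
    linear_combination -this
  obtain ⟨y₀, hy₀⟩ := hJne
  obtain ⟨y₁, hy₁, hne⟩ := (infinite_of_mem_nhds y₀ (hJ.mem_nhds hy₀)).nontrivial.exists_ne y₀
  have hA : A * deriv (deriv u) x = 0 := by
    refine (mul_eq_zero.mp ?_).resolve_left (sub_ne_zero.mpr hne)
    linear_combination key y₁ hy₁ - key y₀ hy₀
  have hpos : 1 + A ^ 2 = 0 := by
    linear_combination key y₀ hy₀ - (deriv u x + y₀) * hA
  linarith [sq_nonneg A]
end

section
/- Let C₁, C₂ ∈ ℝ with C₂ ≠ 0, let I ⊆ ℝ be an open interval, and let u : I → ℝ be a C² function such that u''(x) ≠ 0 and (u'(x) + C₁)·u''(x) = C₂ for all x ∈ I. Then there exist constants C₃, C₄ ∈ ℝ and a sign ε ∈ {−1, +1} such that 2C₂x + C₃ > 0 and u(x) = −C₁x + ε(2C₂x + C₃)^{3/2}/(3C₂) + C₄ for all x ∈ I. -/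
/-- Solving the ODE `(u' + C₁)u'' = C₂ ≠ 0` (with `u''` never zero) on an open interval:
the solutions are `u(x) = −C₁x + ε(2C₂x + C₃)^{3/2}/(3C₂) + C₄` with `2C₂x + C₃ > 0`
and `ε = ±1`. -/
theorem flat_translation_surface_ode
    (C₁ C₂ : ℝ) (hC₂ : C₂ ≠ 0)
    (I : Set ℝ) (hI : IsOpen I) (hI' : I.OrdConnected)
    (u : ℝ → ℝ) (hu : ContDiffOn ℝ 2 u I)
    (hu'' : ∀ x ∈ I, deriv (deriv u) x ≠ 0)
    (hode : ∀ x ∈ I, (deriv u x + C₁) * deriv (deriv u) x = C₂) :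
    ∃ C₃ C₄ ε : ℝ, (ε = 1 ∨ ε = -1) ∧
      ∀ x ∈ I, 0 < 2 * C₂ * x + C₃ ∧
        u x = -C₁ * x + ε * (2 * C₂ * x + C₃) ^ ((3 : ℝ) / 2) / (3 * C₂) + C₄ := by
  have hconn : IsPreconnected I := hI'.isPreconnected
  have hu_diff : ∀ x ∈ I, HasDerivAt u (deriv u x) x := fun x hx =>
    ((hu.differentiableOn (by norm_num)).differentiableAt (hI.mem_nhds hx)).hasDerivAt
  have hw_diff : ∀ x ∈ I, HasDerivAt (fun y => deriv u y + C₁) (deriv (deriv u) x) x :=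
    fun x hx => (differentiableAt_of_deriv_ne_zero (hu'' x hx)).hasDerivAt.add_const C₁
  have hw_ne : ∀ x ∈ I, deriv u x + C₁ ≠ 0 := fun x hx h => hC₂ (by
    rw [← hode x hx, h, zero_mul])
  -- The derivative of `(deriv u + C₁) ^ 2` is the constant `2 * C₂`.
  obtain ⟨C₃, hC₃⟩ : ∃ C₃, ∀ x ∈ I, (deriv u x + C₁) ^ 2 - 2 * C₂ * x = C₃ := by
    have hd : ∀ x ∈ I, HasDerivAt (fun y => (deriv u y + C₁) ^ 2 - 2 * C₂ * y) 0 x := by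
      intro x hx
      refine (((hw_diff x hx).pow 2).sub ((hasDerivAt_id x).const_mul (2 * C₂))).congr_deriv ?_
      push_cast
      linear_combination 2 * hode x hx
    exact hI.exists_is_const_of_deriv_eq_zero hconn
      (fun x hx => (hd x hx).differentiableAt.differentiableWithinAt)
      (fun x hx => (hd x hx).deriv)
  have hsq : ∀ x ∈ I, (deriv u x + C₁) ^ 2 = 2 * C₂ * x + C₃ := fun x hx => by
    linear_combination hC₃ x hx
  have hpos : ∀ x ∈ I, 0 < 2 * C₂ * x + C₃ := fun x hx => by
    rw [← hsq x hx]
    exact sq_pos_of_ne_zero (hw_ne x hx)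
  -- By connectedness, `deriv u + C₁` is a fixed branch of the square root.
  obtain ⟨ε, hε, hw⟩ : ∃ ε : ℝ, (ε = 1 ∨ ε = -1) ∧
      ∀ x ∈ I, deriv u x + C₁ = ε * √(2 * C₂ * x + C₃) := by
    rcases hconn.eq_or_eq_neg_of_sq_eq (f := fun y => deriv u y + C₁)
      (g := fun y => √(2 * C₂ * y + C₃))
      (fun x hx => (hw_diff x hx).continuousAt.continuousWithinAt) (by fun_prop)
      (fun x hx => by
        simp only [Pi.pow_apply]
        rw [hsq x hx, Real.sq_sqrt (hpos x hx).le])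
      (fun {x} hx => (Real.sqrt_pos.2 (hpos x hx)).ne') with h | h
    · exact ⟨1, Or.inl rfl, fun x hx => by simpa using h hx⟩
    · exact ⟨-1, Or.inr rfl, fun x hx => by simpa using h hx⟩
  obtain ⟨C₄, hC₄⟩ : ∃ C₄, ∀ x ∈ I,
      u x + C₁ * x - ε * (2 * C₂ * x + C₃) ^ ((3 : ℝ) / 2) / (3 * C₂) = C₄ := by
    have hd : ∀ x ∈ I, HasDerivAt
        (fun y => u y + C₁ * y - ε * (2 * C₂ * y + C₃) ^ ((3 : ℝ) / 2) / (3 * C₂)) 0 x := by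
      intro x hx
      have hlin : HasDerivAt (fun y => 2 * C₂ * y + C₃) (2 * C₂) x := by
        simpa using ((hasDerivAt_id x).const_mul (2 * C₂)).add_const C₃
      refine (((hu_diff x hx).add ((hasDerivAt_id x).const_mul C₁)).sub
        (((hlin.rpow_const (p := (3 : ℝ) / 2) (Or.inl (hpos x hx).ne')).const_mul
          ε).div_const (3 * C₂))).congr_deriv ?_
      rw [show (3 : ℝ) / 2 - 1 = 1 / 2 by norm_num, ← Real.sqrt_eq_rpow]
      field_simp
      linear_combination hw x hx
    exact hI.exists_is_const_of_deriv_eq_zero hconn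
      (fun x hx => (hd x hx).differentiableAt.differentiableWithinAt)
      (fun x hx => (hd x hx).deriv)
  exact ⟨C₃, C₄, ε, hε, fun x hx => ⟨hpos x hx, by linear_combination hC₄ x hx⟩⟩
end
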